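/- Let p > 5 be a prime with p ≡ 1 (mod 4). Then every element of ℤ[i]/pℤ[i] is a sum of at most 3 elements of norm 1; i.e., the Cayley graph G_p = Cay(ℤ[i]/pℤ[i], {β : N(β) = 1}) has diameter 3. -/

import Mathlib

/-- The ring `ℤ[i]/pℤ[i]`, modeled as pairs `(a, b)` over `ℤ/pℤ` representing `a + bi`. -/
abbrev R (p : ℕ) := ZMod p × ZMod p

/-- The norm `N(a+bi) = a² + b²`. -/
def Gnorm {p : ℕ} (β : R p) : ZMod p := β.1 ^ 2 + β.2 ^ 2

open Polynomial in
/-- The key polynomial argument (a low-order Stepanov / Manin style argument). -/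
lemma key_poly (p : ℕ) [hpf : Fact p.Prime] (hp17 : 17 < p) (Q K : (ZMod p)[X])
    (hQ : Q.Monic) (hQd : Q.natDegree = 4) (hK : K.Monic) (hKd : K.natDegree = 3)
    (h : ∀ s : ZMod p, K.eval s ≠ 0 → ¬ IsSquare (Q.eval s)) :
    ∃ M : (ZMod p)[X], M ^ 2 = 4 * Q * K ^ 4 := by
  have hp := hpf.out
  have hp2 : p ≠ 2 := by omega
  obtain ⟨n, hn⟩ : ∃ n, p = 2 * n + 1 := by
    rcases hp.eq_two_or_odd' with h2 | h2
    · exact absurd h2 hp2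
    · exact h2
  have hn2 : p / 2 = n := by omega
  have hDd : (X ^ p - X : (ZMod p)[X]).natDegree = p :=
    FiniteField.X_pow_card_sub_X_natDegree_eq _ hp.one_lt
  have hDne : (X ^ p - X : (ZMod p)[X]) ≠ 0 :=
    FiniteField.X_pow_card_sub_X_ne_zero _ hp.one_lt
  have hdvd : ∀ f : (ZMod p)[X], (∀ s, f.eval s = 0) → (X ^ p - X : (ZMod p)[X]) ∣ f := by
    intro f hf
    have hmon : (X ^ p - X : (ZMod p)[X]).Monic :=
      monic_X_pow_sub (by rw [degree_X]; exact_mod_cast hp.one_lt)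
    rw [← modByMonic_eq_zero_iff_dvd hmon]
    apply eq_zero_of_degree_lt_of_eval_finset_eq_zero Finset.univ
    · refine (degree_modByMonic_lt f hmon).trans_le ?_
      rw [degree_eq_natDegree hDne, hDd, Finset.card_univ, ZMod.card]
    · intro s _
      have h1 := congrArg (eval s) (modByMonic_add_div f (X ^ p - X : (ZMod p)[X]))
      simpa [hf s] using h1
  obtain ⟨G, hG⟩ : (X ^ p - X : (ZMod p)[X]) ∣ K * (Q ^ n + 1) := by
    apply hdvd
    intro s
    by_cases hs : K.eval s = 0
    · simp [hs]
    · have h1 := h s hs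
      have h0 : Q.eval s ≠ 0 := by
        intro h0; rw [h0] at h1; exact h1 ⟨0, by simp⟩
      have h2 := ZMod.pow_div_two_eq_neg_one_or_one p h0
      have h3 := ZMod.euler_criterion p h0
      rw [hn2] at h2 h3
      rcases h2 with h2 | h2
      · exact absurd (h3.2 h2) h1
      · simp [h2]
  have hpc : (p : (ZMod p)[X]) = 0 := CharP.cast_eq_zero _ _
  have hnc : (2 * n + 1 : (ZMod p)[X]) = 0 := by
    have := congrArg (fun k : ℕ => (k : (ZMod p)[X])) hn
    simp only [hpc] at this
    push_cast at this
    exact this.symm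
  set D : (ZMod p)[X] := X ^ p - X with hD
  have hD' : derivative D = -1 := by
    simp [hD, derivative_X_pow]
  have hf' : 2 * Q * derivative (Q ^ n) = - derivative Q * Q ^ n := by
    rw [derivative_pow]
    have hn0 : n ≠ 0 := by omega
    obtain ⟨m, rfl⟩ := Nat.exists_eq_succ_of_ne_zero hn0
    simp only [map_natCast, Nat.succ_sub_one, Nat.succ_eq_add_one]
    push_cast at hnc ⊢
    linear_combination (Q ^ (m+1) * derivative Q) * hnc
  have hder : derivative K * (Q ^ n + 1) + K * derivative (Q ^ n) = - G + D * derivative G := by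
    have := congrArg derivative hG
    rw [derivative_mul, derivative_mul, hD', derivative_add, derivative_one] at this
    linear_combination this
  obtain ⟨M, hM⟩ : D ∣ 2 * Q * K * G + K ^ 2 * derivative Q := by
    refine ⟨2 * Q * K * derivative G - 2 * Q * derivative K * G + K * derivative Q * G, ?_⟩
    linear_combination (2 * Q * K) * hder - K ^ 2 * hf' - (2 * Q * derivative K - K * derivative Q) * hG
  have hE : D ^ 2 * M - K ^ 2 * derivative Q * D - 2 * Q * K ^ 2 = 2 * Q * K ^ 2 * Q ^ n := by
    linear_combination (-D) * hM - 2 * Q * K * hG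
  have hQ0 : Q ≠ 0 := hQ.ne_zero
  have hexp : Q ^ p = expand (ZMod p) p Q := (ZMod.expand_card Q).symm
  have hmain : (D ^ 2 * M - K ^ 2 * derivative Q * D - 2 * Q * K ^ 2) ^ 2
      = 4 * Q * K ^ 4 * expand (ZMod p) p Q := by
    have hQp : Q ^ p = Q ^ (2 * n + 1) := congrArg (fun k : ℕ => Q ^ k) hn
    rw [hE, ← hexp, hQp]
    ring
  have hK0 : K ≠ 0 := hK.ne_zero
  have hfd : (Q ^ n + 1).natDegree ≤ 4 * n := by
    refine (natDegree_add_le _ _).trans ?_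
    simp [natDegree_pow, hQd]; omega
  have hGd : G.natDegree ≤ p + 1 := by
    by_cases hG0 : G = 0
    · simp [hG0]
    have h1 := congrArg natDegree hG
    rw [natDegree_mul hDne hG0, hDd] at h1
    have h2 : (K * (Q ^ n + 1)).natDegree ≤ 3 + 4 * n := by
      refine natDegree_mul_le.trans ?_
      omega
    omega
  have hQ'd : (derivative Q).natDegree ≤ 3 := by
    have := natDegree_derivative_le Q
    omega
  have h2d : (2 : (ZMod p)[X]).natDegree = 0 := natDegree_ofNat 2
  have h4d : (4 : (ZMod p)[X]).natDegree = 0 := natDegree_ofNat 4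
  have hMd : M.natDegree ≤ 8 := by
    by_cases hM0 : M = 0
    · simp [hM0]
    have h1 := congrArg natDegree hM
    rw [natDegree_mul hDne hM0, hDd] at h1
    have h2 : (2 * Q * K * G + K ^ 2 * derivative Q).natDegree ≤ p + 8 := by
      refine natDegree_add_le_of_degree_le ?_ ?_
      · have e1 := natDegree_mul_le (p := 2 * Q * K) (q := G)
        have e2 := natDegree_mul_le (p := 2 * Q) (q := K)
        have e3 := natDegree_mul_le (p := 2) (q := Q)
        omega
      · have e1 := natDegree_mul_le (p := K ^ 2) (q := derivative Q)
        have e2 := natDegree_pow_le (p := K) (n := 2)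
        omega
    omega
  -- split off the leading terms
  obtain ⟨L, hL, hLd⟩ : ∃ L : (ZMod p)[X], Q = X ^ 4 + L ∧ L.natDegree ≤ 3 := by
    refine ⟨Q.eraseLead, ?_, ?_⟩
    · have := eraseLead_add_monomial_natDegree_leadingCoeff Q
      rw [hQ.leadingCoeff, hQd] at this
      conv_lhs => rw [← this]
      rw [monomial_one_right_eq_X_pow, add_comm]
    · have := eraseLead_natDegree_le Q
      omega
  have hexpL : expand (ZMod p) p Q = X ^ (4 * p) + expand (ZMod p) p L := by
    conv_lhs => rw [hL]
    rw [map_add, map_pow, expand_X, ← pow_mul, mul_comm p 4]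
  have hexpd : (expand (ZMod p) p L).natDegree ≤ 3 * p := by
    rw [natDegree_expand]; exact Nat.mul_le_mul_right _ hLd
  set E : (ZMod p)[X] := K ^ 2 * (derivative Q * D + 2 * Q) with hEdef
  have hEd : E.natDegree ≤ p + 9 := by
    have e1 : E.natDegree ≤ _ := natDegree_mul_le (p := K ^ 2) (q := derivative Q * D + 2 * Q)
    have e2 := natDegree_pow_le (p := K) (n := 2)
    have e3 : (derivative Q * D + 2 * Q).natDegree ≤ p + 3 := by
      refine natDegree_add_le_of_degree_le ?_ ?_
      · have e1 := natDegree_mul_le (p := derivative Q) (q := D)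
        omega
      · have e3 := natDegree_mul_le (p := 2) (q := Q)
        omega
    omega
  have hXd : (X : (ZMod p)[X]).natDegree = 1 := natDegree_X
  set S : (ZMod p)[X] := X ^ p with hS
  have hSd : S.natDegree = p := natDegree_X_pow p
  have hS4 : (X : (ZMod p)[X]) ^ (4 * p) = S ^ 4 := by rw [hS, ← pow_mul, mul_comm]
  have hid : (4 * Q * K ^ 4 - M ^ 2) * X ^ (4 * p)
      = M ^ 2 * (X * (-4 * S ^ 3 + 6 * X * S ^ 2 - 4 * X ^ 2 * S + X ^ 3))
        - 2 * M * D ^ 2 * E + E ^ 2 - 4 * Q * K ^ 4 * expand (ZMod p) p L := by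
    rw [hexpL] at hmain
    rw [hS4] at hmain ⊢
    rw [hEdef]
    have : D = S - X := hD
    rw [this] at hmain ⊢
    linear_combination -hmain
  refine ⟨M, ?_⟩
  by_contra hne
  have hne' : 4 * Q * K ^ 4 - M ^ 2 ≠ 0 := fun h => hne (sub_eq_zero.1 h).symm
  have hdeg := congrArg natDegree hid
  rw [natDegree_mul_X_pow _ hne'] at hdeg
  have hM2 : (M ^ 2).natDegree ≤ 16 := natDegree_pow_le.trans (by omega)
  have hK4 : (K ^ 4).natDegree ≤ 12 := natDegree_pow_le.trans (by omega)
  have hD2 : (D ^ 2).natDegree ≤ 2 * p := natDegree_pow_le.trans (by omega)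
  have hE2 : (E ^ 2).natDegree ≤ 2 * p + 18 := natDegree_pow_le.trans (by omega)
  have b1 : (X * (-4 * S ^ 3 + 6 * X * S ^ 2 - 4 * X ^ 2 * S + X ^ 3) : (ZMod p)[X]).natDegree
      ≤ 3 * p + 1 := by
    have a1 : (-4 * S ^ 3 : (ZMod p)[X]).natDegree ≤ 3 * p := by
      have : (-4 * S ^ 3 : (ZMod p)[X]) = C (-4) * S ^ 3 := by simp only [map_neg, map_ofNat]
      rw [this]
      exact (natDegree_C_mul_le _ _).trans (natDegree_pow_le.trans (by omega))
    have a2 : (6 * X * S ^ 2 : (ZMod p)[X]).natDegree ≤ 3 * p := by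
      have : (6 * X * S ^ 2 : (ZMod p)[X]) = C 6 * (X * S ^ 2) := by rw [map_ofNat, mul_assoc]
      rw [this]
      refine (natDegree_C_mul_le _ _).trans (natDegree_mul_le.trans ?_)
      have := natDegree_pow_le (p := S) (n := 2)
      omega
    have a3 : (4 * X ^ 2 * S : (ZMod p)[X]).natDegree ≤ 3 * p := by
      have : (4 * X ^ 2 * S : (ZMod p)[X]) = C 4 * (X ^ 2 * S) := by rw [map_ofNat, mul_assoc]
      rw [this]
      refine (natDegree_C_mul_le _ _).trans (natDegree_mul_le.trans ?_)
      have := natDegree_pow_le (p := (X : (ZMod p)[X])) (n := 2)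
      omega
    have a4 : (X ^ 3 : (ZMod p)[X]).natDegree ≤ 3 * p := natDegree_pow_le.trans (by omega)
    have a5 := natDegree_add_le_of_le
      (natDegree_sub_le_of_le (natDegree_add_le_of_le a1 a2) a3) a4
    refine natDegree_mul_le.trans ?_
    simp only [max_self] at a5
    omega
  have c1 : (M ^ 2 * (X * (-4 * S ^ 3 + 6 * X * S ^ 2 - 4 * X ^ 2 * S + X ^ 3)) :
      (ZMod p)[X]).natDegree ≤ 3 * p + 17 := natDegree_mul_le.trans (by omega)
  have c2 : (2 * M * D ^ 2 * E).natDegree ≤ 3 * p + 17 := by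
    have e1 := natDegree_mul_le (p := 2 * M * D ^ 2) (q := E)
    have e2 := natDegree_mul_le (p := 2 * M) (q := D ^ 2)
    have e3 := natDegree_mul_le (p := 2) (q := M)
    omega
  have c3 : (E ^ 2).natDegree ≤ 3 * p + 17 := by omega
  have c4 : (4 * Q * K ^ 4 * expand (ZMod p) p L).natDegree ≤ 3 * p + 17 := by
    have e1 := natDegree_mul_le (p := 4 * Q * K ^ 4) (q := expand (ZMod p) p L)
    have e2 := natDegree_mul_le (p := 4 * Q) (q := K ^ 4)
    have e3 := natDegree_mul_le (p := 4) (q := Q)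
    omega
  have c5 := natDegree_sub_le_of_le
    (natDegree_add_le_of_le (natDegree_sub_le_of_le c1 c2) c3) c4
  simp only [max_self] at c5
  omega

open Polynomial in
lemma exists_large (p : ℕ) [hpf : Fact p.Prime] (hp17 : 17 < p) (c : ZMod p)
    (hc1 : c ≠ 1) :
    ∃ s y : ZMod p, s ≠ 0 ∧ s ≠ 1 ∧ s ≠ c ∧
      (s - 1) * (s - c) * (s ^ 2 - (c - 3) * s + c) = y ^ 2 := by
  by_contra! hcon
  have h2 : (2 : ZMod p) ≠ 0 := by
    intro h
    have : ((2 : ℕ) : ZMod p) = 0 := by exact_mod_cast h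
    rw [ZMod.natCast_eq_zero_iff] at this
    have := Nat.le_of_dvd (by norm_num) this
    omega
  set q : (ZMod p)[X] := X ^ 2 - C (c - 3) * X + C c with hq
  have hqd : q.natDegree = 2 := by rw [hq]; compute_degree!
  have hqm : q.Monic := by rw [hq]; monicity!
  have hm1 : (X - C 1 : (ZMod p)[X]).Monic := monic_X_sub_C 1
  have hmc : (X - C c : (ZMod p)[X]).Monic := monic_X_sub_C c
  obtain ⟨M, hM⟩ := key_poly p hp17 ((X - C 1) * ((X - C c) * q)) (X * ((X - C 1) * (X - C c)))
    (hm1.mul (hmc.mul hqm))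
    (by rw [hm1.natDegree_mul (hmc.mul hqm), hmc.natDegree_mul hqm, hqd, natDegree_X_sub_C, natDegree_X_sub_C])
    (monic_X.mul (hm1.mul hmc))
    (by rw [monic_X.natDegree_mul (hm1.mul hmc), hm1.natDegree_mul hmc, natDegree_X_sub_C,
      natDegree_X_sub_C, natDegree_X])
    (by
      intro s hs ⟨y, hy⟩
      simp only [eval_mul, eval_X, eval_sub, eval_C, mul_ne_zero_iff, sub_ne_zero] at hs
      apply hcon s y hs.1 hs.2.1 hs.2.2
      simp only [eval_mul, eval_X, eval_sub, eval_C, eval_add, eval_pow, hq] at hy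
      linear_combination hy)
  -- parity of the multiplicity of the root 1
  have hp1 : Prime (X - C 1 : (ZMod p)[X]) := prime_X_sub_C 1
  have hne1 : (X - C 1 : (ZMod p)[X]) ≠ 0 := hp1.ne_zero
  obtain ⟨M1, rfl⟩ : (X - C 1 : (ZMod p)[X]) ∣ M := by
    apply hp1.dvd_of_dvd_pow (n := 2); rw [hM]
    exact ⟨4 * ((X - C c) * q) * (X * ((X - C 1) * (X - C c))) ^ 4, by ring⟩
  obtain ⟨M2, rfl⟩ : (X - C 1 : (ZMod p)[X]) ∣ M1 := by
    apply hp1.dvd_of_dvd_pow (n := 2)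
    refine ⟨4 * ((X - C c) * q) * (X * (X - C c)) ^ 4 * (X - C 1) ^ 2, ?_⟩
    apply mul_left_cancel₀ (pow_ne_zero 2 hne1)
    linear_combination hM
  have hM' : M2 ^ 2 = (X - C 1) * (4 * ((X - C c) * q) * (X * (X - C c)) ^ 4) := by
    apply mul_left_cancel₀ (pow_ne_zero 4 hne1)
    linear_combination hM
  obtain ⟨M3, rfl⟩ : (X - C 1 : (ZMod p)[X]) ∣ M2 := by
    apply hp1.dvd_of_dvd_pow (n := 2); rw [hM']
    exact Dvd.intro _ rfl
  have hM'' : (X - C 1) * M3 ^ 2 = 4 * ((X - C c) * q) * (X * (X - C c)) ^ 4 := by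
    apply mul_left_cancel₀ hne1
    linear_combination hM'
  have := congrArg (eval 1) hM''
  simp only [hq, eval_mul, eval_X, eval_sub, eval_C, eval_add, eval_pow, eval_ofNat, sub_self,
    zero_mul] at this
  have h1c : (1 - c) ≠ 0 := sub_ne_zero.2 (Ne.symm hc1)
  have h16 : (2 : ZMod p) ^ 4 * (1 - c) ^ 5 = 0 := by linear_combination -this
  exact mul_ne_zero (pow_ne_zero _ h2) (pow_ne_zero _ h1c) h16

lemma exists_13 : ∀ c : ZMod 13, c ≠ 0 → c ≠ 1 → ∃ s y : ZMod 13, s ≠ 0 ∧ s ≠ 1 ∧ s ≠ c ∧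
      (s - 1) * (s - c) * (s ^ 2 - (c - 3) * s + c) = y ^ 2 := by
  decide +kernel

lemma exists_17 : ∀ c : ZMod 17, c ≠ 0 → c ≠ 1 → ∃ s y : ZMod 17, s ≠ 0 ∧ s ≠ 1 ∧ s ≠ c ∧
      (s - 1) * (s - c) * (s ^ 2 - (c - 3) * s + c) = y ^ 2 := by
  decide +kernel

lemma exists_three (p : ℕ) [hpf : Fact p.Prime] (hp5 : 5 < p) (hmod : p % 4 = 1) (a b : ZMod p)
    (h0 : a ≠ 0 ∨ b ≠ 0) (h1 : a * b ≠ 1) :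
    ∃ u v w : ZMod p, u ≠ 0 ∧ v ≠ 0 ∧ w ≠ 0 ∧ a = u + v + w ∧ b = u⁻¹ + v⁻¹ + w⁻¹ := by
  have hne : ∀ k : ℕ, 0 < k → k < p → ((k : ℕ) : ZMod p) ≠ 0 := by
    intro k hk hkp h
    rw [ZMod.natCast_eq_zero_iff] at h
    have := Nat.le_of_dvd hk h
    omega
  have h2 : (2 : ZMod p) ≠ 0 := by exact_mod_cast hne 2 (by omega) (by omega)
  have h3 : (3 : ZMod p) ≠ 0 := by exact_mod_cast hne 3 (by omega) (by omega)
  by_cases hb : b = 0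
  · subst hb
    have ha : a ≠ 0 := by simpa using h0
    refine ⟨-a / 3, 2 * a / 3, 2 * a / 3, ?_, ?_, ?_, ?_, ?_⟩
    · simp [ha, h3]
    · simp [ha, h2, h3]
    · simp [ha, h2, h3]
    · field_simp; ring
    · field_simp; ring
  by_cases ha : a = 0
  · subst ha
    refine ⟨(-b / 3)⁻¹, (2 * b / 3)⁻¹, (2 * b / 3)⁻¹, ?_, ?_, ?_, ?_, ?_⟩
    · simp [hb, h3]
    · simp [hb, h2, h3]
    · simp [hb, h2, h3]
    · field_simp; ring
    · simp only [inv_inv]; field_simp; ring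
  have hc0 : a * b ≠ 0 := mul_ne_zero ha hb
  obtain ⟨s, y, hs0, hs1, hsc, hy⟩ : ∃ s y : ZMod p, s ≠ 0 ∧ s ≠ 1 ∧ s ≠ a * b ∧
      (s - 1) * (s - a * b) * (s ^ 2 - (a * b - 3) * s + a * b) = y ^ 2 := by
    by_cases h17 : 17 < p
    · exact exists_large p h17 _ h1
    · have hp := hpf.out
      have : p = 13 ∨ p = 17 := by
        have : p = 9 ∨ p = 13 ∨ p = 17 := by omega
        rcases this with h | h
        · subst h; norm_num at hp
        · exact h
      rcases this with h | h
      · subst h; exact exists_13 _ hc0 h1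
      · subst h; exact exists_17 _ hc0 h1
  have hs1' : s - 1 ≠ 0 := sub_ne_zero.2 hs1
  have hsc' : s - a * b ≠ 0 := sub_ne_zero.2 hsc
  obtain ⟨d, hd⟩ : ∃ d, d = y / (b * (s - 1)) := ⟨_, rfl⟩
  obtain ⟨a', ha'⟩ : ∃ a', a' = a - s / b := ⟨_, rfl⟩
  obtain ⟨v, hv⟩ : ∃ v, v = (a' + d) / 2 := ⟨_, rfl⟩
  obtain ⟨w, hw⟩ : ∃ w, w = (a' - d) / 2 := ⟨_, rfl⟩
  have hsum : v + w = a' := by rw [hv, hw]; field_simp; ring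
  have hprod : v * w * (b * (b * (s - 1))) = (a * b - s) * s := by
    have e1 : v * w * 4 = a' ^ 2 - d ^ 2 := by rw [hv, hw]; field_simp; ring
    have e2 : a' * b = a * b - s := by rw [ha']; field_simp
    have e3 : d ^ 2 * (b * (s - 1)) ^ 2 = y ^ 2 := by rw [hd]; field_simp
    have h4 : (4 : ZMod p) ≠ 0 := by
      have : (4 : ZMod p) = 2 * 2 := by norm_num
      rw [this]; exact mul_ne_zero h2 h2
    apply mul_left_cancel₀ h4
    apply mul_left_cancel₀ hs1'
    linear_combination (b * (s - 1)) ^ 2 * e1 + (s - 1) ^ 2 * (a' * b + a * b - s) * e2 - e3 + hy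
  have hvw : v * w ≠ 0 := by
    intro h
    rw [h, zero_mul] at hprod
    exact mul_ne_zero (fun h => hsc' (by linear_combination -h)) hs0 hprod.symm
  have hv0 : v ≠ 0 := left_ne_zero_of_mul hvw
  have hw0 : w ≠ 0 := right_ne_zero_of_mul hvw
  refine ⟨s / b, v, w, div_ne_zero hs0 hb, hv0, hw0, ?_, ?_⟩
  · rw [add_assoc, hsum, ha']; ring
  · have e2 : a' * b = a * b - s := by rw [ha']; field_simp
    have e5 : v⁻¹ + w⁻¹ = a' / (v * w) := by rw [← hsum]; field_simp; ring
    rw [add_assoc, e5, inv_div]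
    have e6 : a' / (v * w) = b * (s - 1) / s := by
      rw [div_eq_div_iff hvw hs0]
      apply mul_left_cancel₀ hb
      linear_combination s * e2 - hprod
    rw [e6]; field_simp; ring

/-- For a prime `p > 5` with `p ≡ 1 (mod 4)`, every element of `ℤ[i]/pℤ[i]` is a sum of
at most three elements of norm one; i.e. the Cayley graph `G_p` has diameter `3`. -/
theorem diameter_three_of_one_mod_four (p : ℕ) (hp : p.Prime) (hp5 : 5 < p)
    (hmod : p % 4 = 1) (γ : R p) :
    ∃ k ≤ 3, ∃ f : Fin k → R p, (∀ j, Gnorm (f j) = 1) ∧ γ = ∑ j, f j := by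
  have : Fact p.Prime := ⟨hp⟩
  have h2 : (2 : ZMod p) ≠ 0 := by
    intro h
    have : ((2 : ℕ) : ZMod p) = 0 := by exact_mod_cast h
    rw [ZMod.natCast_eq_zero_iff] at this
    have := Nat.le_of_dvd (by norm_num) this
    omega
  obtain ⟨i, hi⟩ : IsSquare (-1 : ZMod p) := ZMod.exists_sq_eq_neg_one_iff.2 (by omega)
  obtain ⟨x, y⟩ := γ
  by_cases hz : x + i * y = 0 ∧ x - i * y = 0
  · refine ⟨0, by norm_num, Fin.elim0, fun j => j.elim0, ?_⟩
    have hx : x = 0 := by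
      apply mul_left_cancel₀ h2; linear_combination hz.1 + hz.2
    have hy : y = 0 := by
      apply mul_left_cancel₀ h2; linear_combination -i * hz.1 + i * hz.2 - 2 * y * hi
    simp [hx, hy]
  by_cases h1 : (x + i * y) * (x - i * y) = 1
  · refine ⟨1, by norm_num, fun _ => (x, y), fun j => ?_, by simp⟩
    simp only [Gnorm]
    linear_combination h1 - y ^ 2 * hi
  obtain ⟨u, v, w, hu, hv, hw, ha, hb⟩ := exists_three p hp5 hmod (x + i * y) (x - i * y)
    (by tauto) h1
  have hN : ∀ u : ZMod p, u ≠ 0 → Gnorm (((u + u⁻¹) / 2, -i * (u - u⁻¹) / 2) : R p) = 1 := by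
    intro u hu
    simp only [Gnorm]
    field_simp
    linear_combination (-(u ^ 2 - 1) ^ 2) * hi
  refine ⟨3, le_rfl, ![((u + u⁻¹) / 2, -i * (u - u⁻¹) / 2), ((v + v⁻¹) / 2, -i * (v - v⁻¹) / 2),
    ((w + w⁻¹) / 2, -i * (w - w⁻¹) / 2)], ?_, ?_⟩
  · intro j
    fin_cases j
    · exact hN u hu
    · exact hN v hv
    · exact hN w hw
  · simp only [Fin.sum_univ_three, Matrix.cons_val]
    clear hN
    generalize u⁻¹ = u', v⁻¹ = v', w⁻¹ = w' at hb ⊢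
    ext
    · simp only [Prod.fst_add]
      apply mul_left_cancel₀ h2
      field_simp
      linear_combination ha + hb
    · simp only [Prod.snd_add]
      apply mul_left_cancel₀ h2
      field_simp
      linear_combination -i * ha + i * hb - 2 * y * hi
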